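/- arXiv:0710.3928 — 2 statements merged into one kernel-verified Lean document; each statement's English description precedes it below -/
import Mathlib

section
/- Let n be divisible by 3, let G be a finite simple graph on V = Fin n for which the balanced planted coloring φ* is a proper 3-coloring, let d ≥ 40 be a real number, and let D ⊆ V be a d-core. Let m be any message state and let v ∈ D. If fewer than d/20 of the neighbors w of v with w ∈ D satisfy m(w→v) ≠ some(φ*(w)), then U(m)(v→u) = some(φ*(v)) for every neighbor u of v, and B(v, m) = some(φ*(v)). -/
open MeasureTheory

/-- The balanced planted 3-coloring on `Fin n`: vertex `v` gets color `v mod 3`. -/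
def plantedColoring (n : ℕ) (v : Fin n) : Fin 3 := ⟨v.val % 3, Nat.mod_lt _ (by norm_num)⟩

/-- A pair of vertices is bichromatic if its two endpoints get distinct planted colors. -/
def Bichrom (n : ℕ) (e : Sym2 (Fin n)) : Prop :=
  Sym2.lift ⟨fun u v => plantedColoring n u ≠ plantedColoring n v,
    fun u v => propext ne_comm⟩ e

/-- The type of bichromatic pairs. -/
abbrev BichromPair (n : ℕ) : Type := {e : Sym2 (Fin n) // Bichrom n e}

noncomputable instance (n : ℕ) : Fintype (BichromPair n) := Fintype.ofFinite _

/-- The Bernoulli measure on `Bool` with parameter `p`. -/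
noncomputable def bernoulliMeasure (p : ℝ) : Measure Bool :=
  ENNReal.ofReal p • Measure.dirac true + ENNReal.ofReal (1 - p) • Measure.dirac false

/-- The planted 3-coloring distribution `𝒢_{n,p,3}`: the product over all bichromatic
pairs of Bernoulli(p) measures on `Bool`. -/
noncomputable def plantedMeasure (n : ℕ) (p : ℝ) : Measure (BichromPair n → Bool) :=
  Measure.pi fun _ => bernoulliMeasure p

/-- The graph of a sample point `ω`: its edges are the bichromatic pairs `e` with
`ω e = true`. -/
def plantedGraph (n : ℕ) (ω : BichromPair n → Bool) : SimpleGraph (Fin n) :=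
  SimpleGraph.fromEdgeSet {e : Sym2 (Fin n) | ∃ h : Bichrom n e, ω ⟨e, h⟩ = true}

/-- `e(S)`: the number of edges of `G` with both endpoints in `S`. -/
noncomputable def edgeCount {V : Type*} (G : SimpleGraph V) (S : Set V) : ℕ :=
  {e : Sym2 V | e ∈ G.edgeSet ∧ ∀ v ∈ e, v ∈ S}.ncard

/-- `D` is a `d`-core: every `v ∈ D` has at least `d/5` neighbors in `D ∩ V_i` for
each color class index `i ≠ φ*(v)`, and at most `d/20` neighbors outside `D`. -/
def IsCore (n : ℕ) (G : SimpleGraph (Fin n)) (d : ℝ) (D : Set (Fin n)) : Prop :=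
  ∀ v ∈ D,
    (∀ i : Fin 3, i ≠ plantedColoring n v →
      d / 5 ≤ ({w : Fin n | G.Adj v w ∧ w ∈ D ∧ plantedColoring n w = i}.ncard : ℝ)) ∧
    ({w : Fin n | G.Adj v w ∧ w ∉ D}.ncard : ℝ) ≤ d / 20

/-- `c_t(u,v,m)`: the number of neighbors `w` of `u` other than `v` with `m(w→u) = some t`. -/
noncomputable def msgCount {V : Type*} (G : SimpleGraph V)
    (m : V → V → Option (Fin 3)) (u v : V) (t : Fin 3) : ℕ :=
  {w : V | G.Adj u w ∧ w ≠ v ∧ m w u = some t}.ncard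

/-- The smallest color minimizing `f`. -/
def argminFin3 (f : Fin 3 → ℕ) : Fin 3 :=
  if f 0 ≤ f 1 ∧ f 0 ≤ f 2 then 0 else if f 1 ≤ f 2 then 1 else 2

open Classical in
/-- Gallager update (threshold τ = 1): `U(m)(u→v) = none` if at least two distinct colors
have count 0, otherwise the smallest color minimizing the count. -/
noncomputable def gallagerUpdate {V : Type*} (G : SimpleGraph V)
    (m : V → V → Option (Fin 3)) : V → V → Option (Fin 3) := fun u v =>
  if ∃ t₁ t₂ : Fin 3, t₁ ≠ t₂ ∧ msgCount G m u v t₁ = 0 ∧ msgCount G m u v t₂ = 0 then none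
  else some (argminFin3 (msgCount G m u v))

/-- The number of neighbors `w` of `u` with `m(w→u) = some t`. -/
noncomputable def outCount {V : Type*} (G : SimpleGraph V)
    (m : V → V → Option (Fin 3)) (u : V) (t : Fin 3) : ℕ :=
  {w : V | G.Adj u w ∧ m w u = some t}.ncard

open Classical in
/-- Output `B(u, m)` of a message state at a vertex `u`. -/
noncomputable def gallagerOutput {V : Type*} (G : SimpleGraph V)
    (m : V → V → Option (Fin 3)) (u : V) : Option (Fin 3) :=
  if ∃ t₁ t₂ : Fin 3, t₁ ≠ t₂ ∧ outCount G m u t₁ = 0 ∧ outCount G m u t₂ = 0 then none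
  else some (argminFin3 (outCount G m u))

/-- The Gallager iterates: `m⁰(u→v) = some (φ u)`, `mⁱ⁺¹ = U(mⁱ)`. -/
noncomputable def gallagerIter {V : Type*} (G : SimpleGraph V) (φ : V → Fin 3) :
    ℕ → V → V → Option (Fin 3)
  | 0 => fun u _ => some (φ u)
  | i + 1 => gallagerUpdate G (gallagerIter G φ i)

/-- A strict minimizer is the smallest minimizing color. -/
theorem argminFin3_eq_of_forall_lt {f : Fin 3 → ℕ} {a : Fin 3}
    (h : ∀ i, i ≠ a → f a < f i) : argminFin3 f = a := by
  have h0 := h 0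
  have h1 := h 1
  have h2 := h 2
  unfold argminFin3
  fin_cases a <;> simp at h0 h1 h2 ⊢ <;> split_ifs <;> first | rfl | omega

/-- If `f` has a strict minimizer, it does not vanish at two distinct colors. -/
theorem not_exists_two_zeros_of_forall_lt {f : Fin 3 → ℕ} {a : Fin 3}
    (h : ∀ i, i ≠ a → f a < f i) :
    ¬∃ t₁ t₂ : Fin 3, t₁ ≠ t₂ ∧ f t₁ = 0 ∧ f t₂ = 0 := by
  rintro ⟨t₁, t₂, hne, h₁, h₂⟩
  have key : ∀ t, f t = 0 → t = a := fun t ht => by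
    by_contra hta
    have := h t hta
    omega
  exact hne ((key t₁ h₁).trans (key t₂ h₂).symm)

theorem gallagerUpdate_eq_some_of_forall_lt {V : Type*} {G : SimpleGraph V}
    {m : V → V → Option (Fin 3)} {u v : V} {a : Fin 3}
    (h : ∀ i, i ≠ a → msgCount G m u v a < msgCount G m u v i) :
    gallagerUpdate G m u v = some a := by
  rw [gallagerUpdate, if_neg (not_exists_two_zeros_of_forall_lt h), argminFin3_eq_of_forall_lt h]

theorem gallagerOutput_eq_some_of_forall_lt {V : Type*} {G : SimpleGraph V}
    {m : V → V → Option (Fin 3)} {u : V} {a : Fin 3}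
    (h : ∀ i, i ≠ a → outCount G m u a < outCount G m u i) :
    gallagerOutput G m u = some a := by
  rw [gallagerOutput, if_neg (not_exists_two_zeros_of_forall_lt h), argminFin3_eq_of_forall_lt h]

theorem msgCount_le_outCount {V : Type*} [Finite V] (G : SimpleGraph V)
    (m : V → V → Option (Fin 3)) (u v : V) (t : Fin 3) :
    msgCount G m u v t ≤ outCount G m u t :=
  Set.ncard_le_ncard (fun _ hw => ⟨hw.1, hw.2.2⟩) (Set.toFinite _)

theorem outCount_le_msgCount_add_one {V : Type*} [Finite V] (G : SimpleGraph V)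
    (m : V → V → Option (Fin 3)) (u v : V) (t : Fin 3) :
    outCount G m u t ≤ msgCount G m u v t + 1 := by
  refine (Set.ncard_le_ncard (t := insert v {w : V | G.Adj u w ∧ w ≠ v ∧ m w u = some t})
    (fun w hw => ?_) (Set.toFinite _)).trans (Set.ncard_insert_le _ _)
  by_cases hwv : w = v
  · exact Or.inl hwv
  · exact Or.inr ⟨hw.1, hwv, hw.2⟩

/-- Messages carrying the color of `v` come from outside `D` or are wrong: no neighbor of `v`
has the color of `v`. -/
theorem outCount_plantedColoring_le {n : ℕ} {G : SimpleGraph (Fin n)}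
    (hproper : ∀ u v : Fin n, G.Adj u v → plantedColoring n u ≠ plantedColoring n v)
    (D : Set (Fin n)) (m : Fin n → Fin n → Option (Fin 3)) (v : Fin n) :
    outCount G m v (plantedColoring n v) ≤ {w : Fin n | G.Adj v w ∧ w ∉ D}.ncard +
      {w : Fin n | G.Adj v w ∧ w ∈ D ∧ m w v ≠ some (plantedColoring n w)}.ncard := by
  refine (Set.ncard_le_ncard (fun w hw => ?_) (Set.toFinite _)).trans (Set.ncard_union_le _ _)
  by_cases hwD : w ∈ D
  · refine Or.inr ⟨hw.1, hwD, fun h => hproper v w hw.1 ?_⟩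
    exact Option.some.inj (hw.2.symm.trans h)
  · exact Or.inl ⟨hw.1, hwD⟩

/-- Neighbors of `v` in `D` of color `i` send the message `i` unless they are wrong. -/
theorem ncard_color_le_outCount_add {n : ℕ} (G : SimpleGraph (Fin n))
    (D : Set (Fin n)) (m : Fin n → Fin n → Option (Fin 3)) (v : Fin n) (i : Fin 3) :
    {w : Fin n | G.Adj v w ∧ w ∈ D ∧ plantedColoring n w = i}.ncard ≤ outCount G m v i +
      {w : Fin n | G.Adj v w ∧ w ∈ D ∧ m w v ≠ some (plantedColoring n w)}.ncard := by
  refine (Set.ncard_le_ncard (fun w hw => ?_) (Set.toFinite _)).trans (Set.ncard_union_le _ _)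
  by_cases hmsg : m w v = some (plantedColoring n w)
  · exact Or.inl ⟨hw.1, hw.2.2 ▸ hmsg⟩
  · exact Or.inr ⟨hw.1, hw.2.1, hmsg⟩

/-- a core vertex with fewer than `d/20` wrongly-messaging core neighbors
sends the planted color after one update, and its output is the planted color. -/
theorem core_vertex_correct_update (n : ℕ) (hn : 3 ∣ n) (G : SimpleGraph (Fin n))
    (hproper : ∀ u v : Fin n, G.Adj u v → plantedColoring n u ≠ plantedColoring n v)
    (d : ℝ) (hd : 40 ≤ d) (D : Set (Fin n)) (hD : IsCore n G d D)
    (m : Fin n → Fin n → Option (Fin 3)) (v : Fin n) (hv : v ∈ D)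
    (hfew : ({w : Fin n | G.Adj v w ∧ w ∈ D ∧ m w v ≠ some (plantedColoring n w)}.ncard : ℝ) <
      d / 20) :
    (∀ u : Fin n, G.Adj v u → gallagerUpdate G m v u = some (plantedColoring n v)) ∧
    gallagerOutput G m v = some (plantedColoring n v) := by
  have gap : ∀ i, i ≠ plantedColoring n v →
      outCount G m v (plantedColoring n v) + 1 < outCount G m v i := fun i hi => by
    have hlow := (hD v hv).1 i hi
    have hout := (hD v hv).2
    have hown := outCount_plantedColoring_le hproper D m v
    have hother := ncard_color_le_outCount_add G D m v i
    rify at hown hother ⊢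
    linarith
  refine ⟨fun u _ => gallagerUpdate_eq_some_of_forall_lt fun i hi => ?_,
    gallagerOutput_eq_some_of_forall_lt fun i hi => (Nat.lt_succ_self _).trans (gap i hi)⟩
  have hgap := gap i hi
  have hle := msgCount_le_outCount G m v u (plantedColoring n v)
  have hge := outCount_le_msgCount_add_one G m v u i
  omega
end

section
/- Let G be a finite simple graph that is acyclic (contains no cycle). On the set of ordered pairs (u,v) of adjacent vertices of G, define the relation ≺ by: (w,u') ≺ (u,v) if and only if u' = u, w is adjacent to u, and w ≠ v. Then ≺ is well-founded (there is no infinite descending ≺-chain of ordered pairs of adjacent vertices). -/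
open MeasureTheory

/-- In an acyclic graph, an oriented edge that begins a path is accessible for the relation of
non-backtracking predecessors: each predecessor extends the path, and paths have bounded length. -/
theorem SimpleGraph.IsAcyclic.acc_of_isPath {V : Type*} [Fintype V] {G : SimpleGraph V}
    (hG : G.IsAcyclic) (n : ℕ) (b : {q : V × V // G.Adj q.1 q.2}) {x : V}
    (p : G.Walk b.1.1 x) (hp : p.IsPath) (hsnd : p.snd = b.1.2)
    (hn : Fintype.card V ≤ n + p.length) :
    Acc (fun a b : {q : V × V // G.Adj q.1 q.2} =>
      a.1.2 = b.1.1 ∧ G.Adj a.1.1 b.1.1 ∧ a.1.1 ≠ b.1.2) b := by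
  induction n generalizing b with
  | zero =>
    have := hp.length_lt
    omega
  | succ n ih =>
    refine Acc.intro b fun a ⟨h, hadj, hne⟩ => ih a (.cons hadj p) ?_ ?_ ?_
    · refine hp.cons fun hmem => hne ?_
      exact (hG.eq_snd_of_adj_start hp hadj.symm hmem).trans hsnd
    · simpa using h.symm
    · rw [SimpleGraph.Walk.length_cons]
      omega

/-- on a finite acyclic graph, the relation "(w,u') precedes (u,v) iff
u' = u, w is adjacent to u and w ≠ v" on ordered pairs of adjacent vertices is
well-founded. -/
theorem acyclic_message_relation_wellFounded {V : Type*} [Fintype V]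
    (G : SimpleGraph V) (hG : G.IsAcyclic) :
    WellFounded (fun a b : {q : V × V // G.Adj q.1 q.2} =>
      a.1.2 = b.1.1 ∧ G.Adj a.1.1 b.1.1 ∧ a.1.1 ≠ b.1.2) := by
  refine ⟨fun b => hG.acc_of_isPath (Fintype.card V) b b.2.toWalk ?_ ?_ (Nat.le_add_right _ _)⟩
  · exact SimpleGraph.Walk.IsPath.of_adj b.2
  · simp
end
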